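/- Let 𝒜 ⊆ ℂ^N be an irreducible algebraic set of positive dimension (equivalently, infinite) and let f : 𝒜 → ℂ^M be a proper polynomial mapping on 𝒜. Then ρ(f,𝒜) := limsup_{𝒜∋z→∞} log‖f(z)‖/log‖z‖ is finite and nonnegative, and for every nonempty compact set K ⊆ f(𝒜) and every z ∈ 𝒜: V_K(f(z)) ≤ ρ(f,𝒜) · V_{f⁻¹(K)}(z) (with the convention t·(+∞) = +∞ for t > 0). -/

import Mathlib

open Filter MvPolynomial Metric Set ENNReal

/-- extended logarithm of a nonnegative real number, with `elog 0 = -∞`. -/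
noncomputable def elog (t : ℝ) : EReal := if t = 0 then ⊥ else ((Real.log t : ℝ) : EReal)

/-- the filter of points of `V` whose norm tends to infinity. -/
def atInftyOn {E : Type*} [Norm E] (V : Set E) : Filter E :=
  (Filter.comap (fun z => ‖z‖) Filter.atTop) ⊓ Filter.principal V

/-- the quotient `log ‖f z‖ / log ‖z‖`, computed in the extended reals. -/
noncomputable def logRatio {E F : Type*} [Norm E] [Norm F] (f : E → F) (z : E) : EReal :=
  elog ‖f z‖ / elog ‖z‖

/-- the growth exponent `ρ(f, V)` of `f` on `V`. -/
noncomputable def growthExp {E F : Type*} [Norm E] [Norm F] (f : E → F) (V : Set E) : EReal :=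
  Filter.limsup (logRatio f) (atInftyOn V)

/-- `log ‖f⁻¹(w)‖ = log sup {‖z‖ : z ∈ V, f z = w}`, computed in the extended reals
(`-∞` for an empty fiber). -/
noncomputable def fiberLogNorm {E F : Type*} [Norm E] [Norm F] (f : E → F) (V : Set E)
    (w : F) : EReal :=
  sSup ((fun z => elog ‖z‖) '' {z | z ∈ V ∧ f z = w})

/-- the order `ρ(f⁻¹, f(V))` of `f` on `V`: the growth exponent of the multifunction `f⁻¹`
on `f(V)`. -/
noncomputable def orderExp {E F : Type*} [Norm E] [Norm F] (f : E → F) (V : Set E) : EReal :=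
  Filter.limsup (fun w => fiberLogNorm f V w / elog ‖w‖) (atInftyOn (f '' V))

/-- the Łojasiewicz exponent at infinity `L∞(f|V)`, with `sup ∅ = -∞`. -/
noncomputable def lojExp {E F : Type*} [Norm E] [Norm F] (f : E → F) (V : Set E) : EReal :=
  sSup {x : EReal | ∃ d : ℝ, x = (d : EReal) ∧
    ∃ C : ℝ, 0 < C ∧ ∃ R : ℝ, 0 < R ∧ ∀ z ∈ V, R < ‖z‖ → C * ‖z‖ ^ d < ‖f z‖}

/-- inverse on `[0,+∞] ⊆ EReal` with the conventions `1/∞ = 0` and `1/0 = ∞`. -/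
noncomputable def invE (x : EReal) : EReal :=
  if x = ⊤ then 0 else if x = 0 then ⊤ else (((x.toReal)⁻¹ : ℝ) : EReal)

/-- evaluation of a polynomial of `n` variables at a point of `ℂⁿ`. -/
noncomputable def evalAt {n : ℕ} (z : EuclideanSpace ℂ (Fin n))
    (p : MvPolynomial (Fin n) ℂ) : ℂ :=
  MvPolynomial.eval (fun i => z i) p

/-- an algebraic subset of `ℂⁿ`: the common zero set of finitely many polynomials. -/
def IsAlgebraicSet {n : ℕ} (A : Set (EuclideanSpace ℂ (Fin n))) : Prop :=
  ∃ S : Finset (MvPolynomial (Fin n) ℂ), A = {z | ∀ p ∈ S, evalAt z p = 0}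

/-- the ideal of all polynomials vanishing identically on `A`. -/
noncomputable def vanishIdeal {n : ℕ} (A : Set (EuclideanSpace ℂ (Fin n))) :
    Ideal (MvPolynomial (Fin n) ℂ) :=
  RingHom.ker (Pi.ringHom fun z : A =>
    MvPolynomial.eval (fun i => (z : EuclideanSpace ℂ (Fin n)) i))

/-- a polynomial mapping on `A`: the restriction to `A` of a mapping all of whose
components are polynomials. -/
def IsPolyMapOn {N M : ℕ} (f : EuclideanSpace ℂ (Fin N) → EuclideanSpace ℂ (Fin M))
    (A : Set (EuclideanSpace ℂ (Fin N))) : Prop :=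
  ∃ P : Fin M → MvPolynomial (Fin N) ℂ, ∀ z ∈ A, ∀ j, f z j = evalAt z (P j)

/-- a holomorphic mapping on `A`: locally the restriction of a holomorphic mapping on an
open subset of the ambient space. -/
def IsHoloOn {N M : ℕ} (f : EuclideanSpace ℂ (Fin N) → EuclideanSpace ℂ (Fin M))
    (A : Set (EuclideanSpace ℂ (Fin N))) : Prop :=
  ∀ z ∈ A, ∃ U : Set (EuclideanSpace ℂ (Fin N)), IsOpen U ∧ z ∈ U ∧
    ∃ F : EuclideanSpace ℂ (Fin N) → EuclideanSpace ℂ (Fin M),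
      DifferentiableOn ℂ F U ∧ Set.EqOn f F (U ∩ A)

/-- the pluricomplex Green function of a compact set `K ⊆ ℂⁿ`, in its Siciak–Zaharjuta
polynomial form `V_K(z) = sup { (deg q)⁻¹ · log⁺ |q(z)| }`. -/
noncomputable def greenV {n : ℕ} (K : Set (EuclideanSpace ℂ (Fin n)))
    (z : EuclideanSpace ℂ (Fin n)) : EReal :=
  sSup {x : EReal | ∃ q : MvPolynomial (Fin n) ℂ, 1 ≤ q.totalDegree ∧
    (∀ w ∈ K, ‖evalAt w q‖ ≤ 1) ∧
    x = (((q.totalDegree : ℝ)⁻¹ * max (Real.log ‖evalAt z q‖) 0 : ℝ) : EReal)}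


lemma aux_coeff_line {n : ℕ} (F : MvPolynomial (Fin n) ℂ) (v : Fin n → ℂ) (D : ℕ) :
    (aeval (fun i => Polynomial.C (v i) * Polynomial.X) F : Polynomial ℂ).coeff D
      = eval v (homogeneousComponent D F) := by
  induction F using MvPolynomial.induction_on' with
  | monomial s a =>
    have hdeg : s.degree = ∑ i ∈ s.support, s i := rfl
    have h1 : (aeval (fun i => Polynomial.C (v i) * Polynomial.X) (monomial s a) : Polynomial ℂ)
        = Polynomial.C (a * s.prod fun i k => v i ^ k) * Polynomial.X ^ s.degree := by
      rw [aeval_monomial, hdeg]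
      simp only [mul_pow, Finsupp.prod, Finset.prod_mul_distrib,
        Finset.prod_pow_eq_pow_sum, map_mul, map_prod, map_pow, Polynomial.algebraMap_eq]
      ring
    rw [h1, Polynomial.coeff_C_mul_X_pow]
    by_cases h : D = s.degree
    · rw [if_pos h, homogeneousComponent_of_mem (isHomogeneous_monomial a h.symm), if_pos rfl,
        eval_monomial]
    · rw [if_neg h, homogeneousComponent_of_mem (isHomogeneous_monomial a rfl), if_neg h, map_zero]
  | add p q hp hq => simp [hp, hq]

lemma aux_line_eval {n : ℕ} (F : MvPolynomial (Fin n) ℂ) (v : Fin n → ℂ) (t : ℂ) :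
    (aeval (fun i => Polynomial.C (v i) * Polynomial.X) F : Polynomial ℂ).eval t
      = eval (fun i => v i * t) F := by
  have : ((Polynomial.aeval t).comp (aeval (fun i => Polynomial.C (v i) * Polynomial.X)) :
      MvPolynomial (Fin n) ℂ →ₐ[ℂ] ℂ) = aeval (fun i => v i * t) := by
    ext i; simp
  have := congrArg (fun h => h F) this
  simpa [Polynomial.coe_aeval_eq_eval, MvPolynomial.coe_aeval_eq_eval] using this

lemma aux_top_ne {n : ℕ} {F : MvPolynomial (Fin n) ℂ} (hF : F ≠ 0) :
    homogeneousComponent F.totalDegree F ≠ 0 := by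
  obtain ⟨s, hs, hsd⟩ : ∃ s ∈ F.support, F.totalDegree = s.degree := by
    have hne : F.support.Nonempty := by
      rwa [Finset.nonempty_iff_ne_empty, Ne, support_eq_empty]
    obtain ⟨s, hs, h⟩ := Finset.exists_mem_eq_sup F.support hne (fun s => s.sum fun _ e => e)
    exact ⟨s, hs, h⟩
  intro h
  have := congrArg (coeff s) h
  rw [coeff_homogeneousComponent, if_pos hsd.symm, coeff_zero] at this
  exact (mem_support_iff.1 hs) this

lemma aux_poly_growth (L : Polynomial ℂ) (s C : ℝ) (hL : L ≠ 0)
    (h : ∀ t : ℝ, 1 ≤ t → ‖L.eval (t : ℂ)‖ ≤ C * t ^ s) : (L.natDegree : ℝ) ≤ s := by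
  by_contra hlt
  push Not at hlt
  have h1 : Tendsto (fun t : ℝ => ‖L.reverse.eval ((t : ℂ)⁻¹)‖) atTop
      (nhds ‖L.reverse.eval 0‖) := by
    have h2 : Tendsto (fun t : ℝ => ((t : ℂ)⁻¹)) atTop (nhds 0) := by
      have := (Complex.continuous_ofReal.tendsto 0).comp (tendsto_inv_atTop_zero (𝕜 := ℝ))
      simpa [Function.comp_def] using this
    exact ((L.reverse.continuous.tendsto 0).comp h2).norm
  have h3 : Tendsto (fun t : ℝ => C * t ^ (s - L.natDegree)) atTop (nhds 0) := by
    have := (tendsto_rpow_neg_atTop (y := L.natDegree - s) (by linarith)).const_mul C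
    simpa using this
  have h4 : ‖L.reverse.eval 0‖ ≤ 0 := by
    refine le_of_tendsto_of_tendsto h1 h3 ?_
    filter_upwards [eventually_ge_atTop (1 : ℝ)] with t ht
    have ht0 : (0 : ℝ) < t := by linarith
    have htc : (t : ℂ) ≠ 0 := by exact_mod_cast ht0.ne'
    let _ := invertibleOfNonzero htc
    have h5 := Polynomial.eval₂_reverse_mul_pow (RingHom.id ℂ) (t : ℂ) L
    rw [invOf_eq_inv] at h5
    have h6 := congrArg norm h5
    rw [norm_mul, norm_pow, Complex.norm_real, Real.norm_of_nonneg ht0.le] at h6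
    have h7 := h t ht
    rw [Polynomial.eval, ← h6] at h7
    rw [Real.rpow_sub ht0, Real.rpow_natCast, mul_div_assoc', le_div_iff₀ (by positivity)]
    exact h7
  have h5 : L.reverse.eval 0 = 0 := by simpa using h4
  rw [← Polynomial.coeff_zero_eq_eval_zero, Polynomial.coeff_zero_reverse] at h5
  exact hL (Polynomial.leadingCoeff_eq_zero.1 h5)

lemma aux_degree_le {n : ℕ} (F : MvPolynomial (Fin n) ℂ) (s C : ℝ) (hs : 0 ≤ s) (hC : 0 ≤ C)
    (h : ∀ v : Fin n → ℂ, ‖eval v F‖ ≤ C * (1 + ∑ i, ‖v i‖) ^ s) :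
    (F.totalDegree : ℝ) ≤ s := by
  by_cases hF : F = 0
  · simpa [hF] using hs
  obtain ⟨v, hv⟩ : ∃ v, eval v (homogeneousComponent F.totalDegree F) ≠ 0 := by
    by_contra hcon
    push Not at hcon
    exact aux_top_ne hF (MvPolynomial.funext fun v => by simpa using hcon v)
  set L : Polynomial ℂ := aeval (fun i => Polynomial.C (v i) * Polynomial.X) F with hLdef
  have hc : L.coeff F.totalDegree ≠ 0 := by rw [hLdef, aux_coeff_line]; exact hv
  have hL : L ≠ 0 := by rintro h0; rw [h0] at hc; simp at hc
  have hd : F.totalDegree ≤ L.natDegree := Polynomial.le_natDegree_of_ne_zero hc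
  refine le_trans (by exact_mod_cast hd)
    (aux_poly_growth L s (C * (1 + ∑ i, ‖v i‖) ^ s) hL fun t ht => ?_)
  rw [hLdef, aux_line_eval]
  refine (h _).trans ?_
  have hS : 0 ≤ ∑ i, ‖v i‖ := Finset.sum_nonneg fun _ _ => norm_nonneg _
  rw [mul_assoc, ← Real.mul_rpow (by positivity) (by linarith)]
  gcongr
  simp only [norm_mul, Complex.norm_real, Real.norm_of_nonneg (by linarith : (0 : ℝ) ≤ t)]
  rw [← Finset.sum_mul]
  nlinarith

lemma aux_bound {n : ℕ} (F : MvPolynomial (Fin n) ℂ) (k : ℕ) (hk : F.totalDegree ≤ k) :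
    ∃ C : ℝ, 0 ≤ C ∧ ∀ v : Fin n → ℂ, ‖eval v F‖ ≤ C * (1 + ∑ i, ‖v i‖) ^ k := by
  refine ⟨∑ s ∈ F.support, ‖coeff s F‖, Finset.sum_nonneg fun _ _ => norm_nonneg _, fun v => ?_⟩
  have hS : 0 ≤ ∑ i, ‖v i‖ := Finset.sum_nonneg fun _ _ => norm_nonneg _
  rw [eval_eq', Finset.sum_mul]
  refine (norm_sum_le _ _).trans (Finset.sum_le_sum fun s hs => ?_)
  rw [norm_mul, norm_prod]
  gcongr
  have h1 : ∏ i, ‖v i ^ s i‖ ≤ ∏ i, (1 + ∑ i, ‖v i‖) ^ s i := by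
    refine Finset.prod_le_prod (fun _ _ => norm_nonneg _) fun i _ => ?_
    rw [norm_pow]
    gcongr
    have := Finset.single_le_sum (f := fun i => ‖v i‖) (fun _ _ => norm_nonneg _)
      (Finset.mem_univ i)
    linarith
  refine h1.trans ?_
  rw [Finset.prod_pow_eq_pow_sum]
  refine pow_le_pow_right₀ (by linarith) (le_trans ?_ hk)
  have := le_totalDegree hs
  rwa [Finsupp.sum_fintype _ _ (fun _ => rfl)] at this

/-- substitution of polynomials of degree at most one does not raise the degree. -/
lemma aux_totalDegree_aeval {n m : ℕ} (F : MvPolynomial (Fin n) ℂ)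
    (ℓ : Fin n → MvPolynomial (Fin m) ℂ) (hℓ : ∀ i, (ℓ i).totalDegree ≤ 1) :
    (aeval ℓ F).totalDegree ≤ F.totalDegree := by
  rw [aeval_def, eval₂_eq']
  refine totalDegree_finsetSum_le fun s hs => ?_
  refine (totalDegree_mul _ _).trans ?_
  rw [algebraMap_eq, totalDegree_C, zero_add]
  refine (totalDegree_finsetProd _ _).trans ?_
  have h1 : ∑ i, (ℓ i ^ s i).totalDegree ≤ ∑ i, s i := by
    refine Finset.sum_le_sum fun i _ => (totalDegree_pow _ _).trans ?_
    have := Nat.mul_le_mul_left (s i) (hℓ i)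
    simpa using this
  refine h1.trans ?_
  have := le_totalDegree hs
  rwa [Finsupp.sum_fintype _ _ (fun _ => rfl)] at this

lemma aux_root_bound {N : ℕ} (G : Polynomial (MvPolynomial (Fin N) ℂ)) (hG : G.Monic)
    (hdeg : ∀ i, i ≤ G.natDegree → (G.coeff i).totalDegree + i ≤ G.natDegree) :
    ∃ C : ℝ, 0 ≤ C ∧ ∀ (y : Fin N → ℂ) (t : ℂ), G.eval₂ (eval y) t = 0 →
      ‖t‖ ≤ C * (1 + ∑ i, ‖y i‖) := by
  have hb : ∀ i, ∃ C : ℝ, 0 ≤ C ∧ (i < G.natDegree → ∀ v : Fin N → ℂ,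
      ‖eval v (G.coeff i)‖ ≤ C * (1 + ∑ i, ‖v i‖) ^ (G.natDegree - i)) := by
    intro i
    by_cases hi : i < G.natDegree
    · obtain ⟨C, h0, h⟩ := aux_bound (G.coeff i) (G.natDegree - i) (by have := hdeg i hi.le; omega)
      exact ⟨C, h0, fun _ => h⟩
    · exact ⟨0, le_rfl, fun h => absurd h hi⟩
  choose c hc0 hc using hb
  set D := G.natDegree with hD
  have hS0 : 0 ≤ ∑ i ∈ Finset.range D, c i := Finset.sum_nonneg fun i _ => hc0 i
  refine ⟨1 + ∑ i ∈ Finset.range D, c i, by linarith, fun y t ht => ?_⟩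
  by_contra hlt
  push Not at hlt
  set Λ := 1 + ∑ i, ‖y i‖ with hΛ
  have hΛ1 : 1 ≤ Λ := by
    have : 0 ≤ ∑ i, ‖y i‖ := Finset.sum_nonneg fun _ _ => norm_nonneg _
    linarith
  have htΛ : Λ ≤ ‖t‖ := by nlinarith
  have ht0 : 0 < ‖t‖ := by linarith
  rw [Polynomial.eval₂_eq_sum_range, Finset.sum_range_succ, ← hD, hG.coeff_natDegree, map_one,
    one_mul] at ht
  have h1 : ‖t‖ ^ D ≤ ∑ i ∈ Finset.range D, ‖eval y (G.coeff i)‖ * ‖t‖ ^ i := by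
    have : t ^ D = - ∑ i ∈ Finset.range D, eval y (G.coeff i) * t ^ i := by
      linear_combination ht
    rw [← norm_pow, this, norm_neg]
    refine (norm_sum_le _ _).trans (le_of_eq ?_)
    simp [norm_pow]
  rcases Nat.eq_zero_or_pos D with h0 | hpos
  · rw [h0] at h1; simp at h1; linarith
  have h2 : ∑ i ∈ Finset.range D, ‖eval y (G.coeff i)‖ * ‖t‖ ^ i
      ≤ ∑ i ∈ Finset.range D, c i * (Λ * ‖t‖ ^ (D - 1)) := by
    refine Finset.sum_le_sum fun i hi => ?_
    have hi' := Finset.mem_range.1 hi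
    have h3 := hc i hi' y
    calc ‖eval y (G.coeff i)‖ * ‖t‖ ^ i ≤ (c i * Λ ^ (D - i)) * ‖t‖ ^ i := by gcongr
      _ = c i * (Λ * (Λ ^ (D - 1 - i) * ‖t‖ ^ i)) := by
        rw [show D - i = (D - 1 - i) + 1 by omega]; ring
      _ ≤ c i * (Λ * (‖t‖ ^ (D - 1 - i) * ‖t‖ ^ i)) := by
        have := hc0 i
        gcongr
      _ = c i * (Λ * ‖t‖ ^ (D - 1)) := by
        rw [← pow_add, show D - 1 - i + i = D - 1 by omega]
  rw [← Finset.sum_mul] at h2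
  have h3 : ‖t‖ ^ D = ‖t‖ * ‖t‖ ^ (D - 1) := by
    rw [← pow_succ', show D - 1 + 1 = D by omega]
  have h4 : 0 < ‖t‖ ^ (D - 1) := by positivity
  have h5 := h1.trans h2
  rw [h3, ← mul_assoc] at h5
  have h6 := le_of_mul_le_mul_right h5 h4
  nlinarith

lemma aux_step {R : Type*} [CommRing R] [Algebra ℂ R] {N : ℕ}
    (x : Fin (N + 1) → R) (hx : ¬ AlgebraicIndependent ℂ x) :
    ∃ (v : Fin N → ℂ) (G : Polynomial (MvPolynomial (Fin N) ℂ)), G.Monic ∧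
      (∀ i, i ≤ G.natDegree → (G.coeff i).totalDegree + i ≤ G.natDegree) ∧
      G.eval₂ ((aeval (fun i => x i.succ - v i • x 0) :
        MvPolynomial (Fin N) ℂ →ₐ[ℂ] R) : MvPolynomial (Fin N) ℂ →+* R) (x 0) = 0 := by
  obtain ⟨F, hFx, hF⟩ : ∃ F : MvPolynomial (Fin (N + 1)) ℂ, aeval x F = 0 ∧ F ≠ 0 := by
    rw [algebraicIndependent_iff] at hx
    push Not at hx
    exact hx
  set D := F.totalDegree with hD
  have hT : homogeneousComponent D F ≠ 0 := aux_top_ne hF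
  obtain ⟨w, hw⟩ : ∃ w, eval w (homogeneousComponent D F * X 0) ≠ 0 := by
    by_contra hcon
    push Not at hcon
    exact mul_ne_zero hT (X_ne_zero (0 : Fin (N + 1))) (MvPolynomial.funext fun v => by
      simpa using hcon v)
  rw [map_mul, eval_X] at hw
  have hw0 : w 0 ≠ 0 := right_ne_zero_of_mul hw
  have hw1 := left_ne_zero_of_mul hw
  -- rescaled direction
  set u : Fin (N + 1) → ℂ := fun i => (w 0)⁻¹ * w i with hu
  have hu0 : u 0 = 1 := by simp [hu, hw0]
  have hu1 : eval u (homogeneousComponent D F) ≠ 0 := by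
    intro h0
    apply hw1
    have hh : w = fun i => u i * w 0 := by
      funext i; simp only [hu]; field_simp
    have := aux_line_eval (homogeneousComponent D F) u (w 0)
    rw [← hh] at this
    rw [← this]
    have hL : (aeval (fun i => Polynomial.C (u i) * Polynomial.X) (homogeneousComponent D F) :
        Polynomial ℂ) = 0 := by
      ext k
      rw [aux_coeff_line, homogeneousComponent_of_mem (homogeneousComponent_isHomogeneous D F)]
      split_ifs
      · simpa using h0
      · simp
    rw [hL]; simp
  set ℓ : Fin (N + 1) → MvPolynomial (Fin (N + 1)) ℂ :=
    Fin.cons (X 0) (fun i => X i.succ + C (u i.succ) * X 0) with hℓ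
  have hℓd : ∀ i, (ℓ i).totalDegree ≤ 1 := by
    intro i
    refine Fin.cases ?_ (fun i => ?_) i
    · simp [hℓ]
    · simp only [hℓ, Fin.cons_succ]
      refine (totalDegree_add _ _).trans (max_le (by simp) ?_)
      refine (totalDegree_mul _ _).trans (by simp)
  set H := aeval ℓ F with hH
  have hHd : H.totalDegree ≤ D := aux_totalDegree_aeval F ℓ hℓd
  set G := finSuccEquiv ℂ N H with hG
  have hGdeg : ∀ i, G.coeff i ≠ 0 → (G.coeff i).totalDegree + i ≤ D := fun i hi =>
    (totalDegree_coeff_finSuccEquiv_add_le H i hi).trans hHd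
  have hfC : ∀ a : ℂ, finSuccEquiv ℂ N (C a) = Polynomial.C (C a) := fun a => by
    simp [finSuccEquiv_apply]
  -- the coefficient of degree `D`
  have hGD : G.coeff D = C (eval u (homogeneousComponent D F)) := by
    have h1 : (G.coeff D).totalDegree = 0 := by
      by_cases h : G.coeff D = 0
      · simp [h]
      · have := hGdeg D h; omega
    rw [totalDegree_eq_zero_iff_eq_C] at h1
    rw [h1]
    congr 1
    rw [← aux_coeff_line]
    have h2 : ((Polynomial.mapAlgHom (aeval (fun _ => (0 : ℂ)) : MvPolynomial (Fin N) ℂ →ₐ[ℂ] ℂ)).comp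
        ((finSuccEquiv ℂ N).toAlgHom.comp (aeval ℓ))) =
        (aeval (fun i => Polynomial.C (u i) * Polynomial.X)) := by
      ext i
      refine Fin.cases ?_ (fun i => ?_) i
      · simp [hℓ, hu0, finSuccEquiv_X_zero]
      · simp [hℓ, finSuccEquiv_X_zero, finSuccEquiv_X_succ, hfC]
    have h3 := congrArg (fun h => (h F).coeff D) h2
    simp only [AlgHom.comp_apply, Polynomial.coe_mapAlgHom, Polynomial.coeff_map] at h3
    rw [← h3]
    change _ = aeval (fun _ => (0 : ℂ)) (G.coeff D)
    rw [h1]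
    simp
  set c := eval u (homogeneousComponent D F) with hc
  have hGn : G.natDegree ≤ D := by
    rw [Polynomial.natDegree_le_iff_coeff_eq_zero]
    intro i hi
    by_contra h
    have := hGdeg i h
    omega
  have hGx : G.eval₂ ((aeval (fun i => x i.succ - u i.succ • x 0) :
        MvPolynomial (Fin N) ℂ →ₐ[ℂ] R) : MvPolynomial (Fin N) ℂ →+* R) (x 0) = 0 := by
    have h2 : ((Polynomial.eval₂AlgHom (aeval (fun i => x i.succ - u i.succ • x 0) :
        MvPolynomial (Fin N) ℂ →ₐ[ℂ] R) (x 0) (fun _ => mul_comm _ _)).comp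
        ((finSuccEquiv ℂ N).toAlgHom.comp (aeval ℓ))) = aeval x := by
      ext i
      refine Fin.cases ?_ (fun i => ?_) i
      · simp only [hℓ, AlgHom.comp_apply, aeval_X, Fin.cons_zero]
        change Polynomial.eval₂ _ _ (finSuccEquiv ℂ N (X 0)) = _
        rw [finSuccEquiv_X_zero, Polynomial.eval₂_X]
      · simp [hℓ, Algebra.smul_def, finSuccEquiv_X_zero, finSuccEquiv_X_succ, hfC]
    have h3 := congrArg (fun h => h F) h2
    simp only [hFx] at h3
    exact h3
  have hmon : (Polynomial.C (C c⁻¹) * G).Monic := by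
    refine Polynomial.monic_of_natDegree_le_of_coeff_eq_one D
      ((Polynomial.natDegree_C_mul_le _ _).trans hGn) ?_
    rw [Polynomial.coeff_C_mul, hGD, ← C_mul, inv_mul_cancel₀ hu1, C_1]
  have hnd : (Polynomial.C (C c⁻¹) * G).natDegree = D := by
    refine le_antisymm ((Polynomial.natDegree_C_mul_le _ _).trans hGn) ?_
    refine Polynomial.le_natDegree_of_ne_zero ?_
    rw [Polynomial.coeff_C_mul, hGD, ← C_mul, inv_mul_cancel₀ hu1, C_1]
    exact one_ne_zero
  refine ⟨fun i => u i.succ, Polynomial.C (C c⁻¹) * G, hmon, fun i hi => ?_, ?_⟩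
  · rw [hnd] at hi ⊢
    rw [Polynomial.coeff_C_mul]
    by_cases h : G.coeff i = 0
    · simpa [h] using hi
    · have h1 := totalDegree_mul (C c⁻¹) (G.coeff i)
      have h2 := hGdeg i h
      rw [totalDegree_C] at h1
      omega
  · rw [Polynomial.eval₂_mul, hGx, mul_zero]

lemma aux_integral_trans {R : Type*} [CommRing R] [Algebra ℂ R] {m N : ℕ} (y : Fin m → R)
    (y' : Fin N → R)
    (hy : ∀ i, ((aeval y : MvPolynomial (Fin m) ℂ →ₐ[ℂ] R) :
      MvPolynomial (Fin m) ℂ →+* R).IsIntegralElem (y' i))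
    (x : R) (G : Polynomial (MvPolynomial (Fin N) ℂ)) (hG : G.Monic)
    (hGx : G.eval₂ ((aeval y' : MvPolynomial (Fin N) ℂ →ₐ[ℂ] R) :
      MvPolynomial (Fin N) ℂ →+* R) x = 0) :
    ((aeval y : MvPolynomial (Fin m) ℂ →ₐ[ℂ] R) :
      MvPolynomial (Fin m) ℂ →+* R).IsIntegralElem x := by
  let h : MvPolynomial (Fin m) ℂ →+* R := (aeval y : MvPolynomial (Fin m) ℂ →ₐ[ℂ] R)
  let _ : Algebra (MvPolynomial (Fin m) ℂ) R := h.toAlgebra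
  let A := integralClosure (MvPolynomial (Fin m) ℂ) R
  have hy' : ∀ i, y' i ∈ A := fun i => hy i
  let k : MvPolynomial (Fin N) ℂ →+* A :=
    eval₂Hom ((algebraMap (MvPolynomial (Fin m) ℂ) A).comp C) (fun i => ⟨y' i, hy' i⟩)
  have hk : (algebraMap A R).comp k = ((aeval y' : MvPolynomial (Fin N) ℂ →ₐ[ℂ] R) :
      MvPolynomial (Fin N) ℂ →+* R) := by
    refine MvPolynomial.ringHom_ext (fun a => ?_) (fun i => ?_)
    · have h1 : k (C a) = algebraMap (MvPolynomial (Fin m) ℂ) A (C a) := by simp [k]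
      rw [RingHom.comp_apply, h1, ← IsScalarTower.algebraMap_apply]
      change aeval y (C a) = aeval y' (C a)
      simp
    · have h1 : k (X i) = ⟨y' i, hy' i⟩ := by simp [k]
      rw [RingHom.comp_apply, h1]
      change y' i = aeval y' (X i)
      simp
  have hx : IsIntegral A x := by
    refine ⟨G.map k, hG.map k, ?_⟩
    rw [Polynomial.eval₂_map, hk, hGx]
  exact isIntegral_trans x hx

lemma aux_noether {R : Type*} [CommRing R] [Nontrivial R] [Algebra ℂ R] : ∀ (N : ℕ) (x : Fin N → R),
    ∃ (m : ℕ) (y : Fin m → R), AlgebraicIndependent ℂ y ∧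
      (∀ j, y j ∈ Submodule.span ℂ (range x)) ∧
      (∀ i, ((aeval y : MvPolynomial (Fin m) ℂ →ₐ[ℂ] R) :
        MvPolynomial (Fin m) ℂ →+* R).IsIntegralElem (x i)) ∧
      ∃ C : ℝ, 0 ≤ C ∧ ∀ (φ : R →ₐ[ℂ] ℂ) (i : Fin N),
        ‖φ (x i)‖ ≤ C * (1 + ∑ j, ‖φ (y j)‖) := by
  intro N
  induction N with
  | zero =>
    intro x
    have hx : AlgebraicIndependent ℂ x := by
      rw [algebraicIndependent_empty_type_iff]
      exact (algebraMap ℂ R).injective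
    exact ⟨0, x, hx, fun j => j.elim0, fun j => j.elim0, 0, le_rfl, fun _ j => j.elim0⟩
  | succ N ih =>
    intro x
    by_cases hx : AlgebraicIndependent ℂ x
    · refine ⟨N + 1, x, hx, fun j => Submodule.subset_span ⟨j, rfl⟩, fun i => ?_, 1, zero_le_one,
        fun φ i => ?_⟩
      · have := ((aeval x : MvPolynomial (Fin (N + 1)) ℂ →ₐ[ℂ] R) :
          MvPolynomial (Fin (N + 1)) ℂ →+* R).isIntegralElem_map (x := X i)
        simpa using this
      · have := Finset.single_le_sum (f := fun i => ‖φ (x i)‖) (fun _ _ => norm_nonneg _)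
          (Finset.mem_univ i)
        linarith
    · obtain ⟨v, G, hG, hGd, hGx⟩ := aux_step x hx
      set y' : Fin N → R := fun i => x i.succ - v i • x 0 with hy'
      obtain ⟨m, y, hy, hspan, hint, C, hC, hb⟩ := ih y'
      obtain ⟨B, hB, hroot⟩ := aux_root_bound G hG hGd
      have hx0 := aux_integral_trans y y' hint (x 0) G hG hGx
      have hb0 : ∀ φ : R →ₐ[ℂ] ℂ,
          ‖φ (x 0)‖ ≤ (B * (1 + N * C)) * (1 + ∑ j, ‖φ (y j)‖) := by
        intro φ
        have h1 : G.eval₂ (eval fun i => φ (y' i)) (φ (x 0)) = 0 := by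
          have h2 := congrArg φ hGx
          rw [map_zero] at h2
          rw [← h2]
          have := Polynomial.hom_eval₂ G ((aeval y' : MvPolynomial (Fin N) ℂ →ₐ[ℂ] R) :
            MvPolynomial (Fin N) ℂ →+* R) (φ : R →+* ℂ) (x 0)
          refine Eq.trans ?_ this.symm
          congr 1
          refine MvPolynomial.ringHom_ext (fun a => ?_) (fun i => ?_)
          · simp
          · simp
        refine (hroot _ _ h1).trans ?_
        have hS : 0 ≤ ∑ j, ‖φ (y j)‖ := Finset.sum_nonneg fun _ _ => norm_nonneg _
        have h3 : ∑ i, ‖φ (y' i)‖ ≤ N * (C * (1 + ∑ j, ‖φ (y j)‖)) := by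
          refine (Finset.sum_le_sum fun i _ => hb φ i).trans ?_
          simp
        rw [mul_assoc]
        gcongr
        nlinarith
      refine ⟨m, y, hy, fun j => ?_, fun i => ?_, ?_⟩
      · refine Submodule.span_le.2 ?_ (hspan j)
        rintro _ ⟨i, rfl⟩
        exact Submodule.sub_mem _ (Submodule.subset_span ⟨_, rfl⟩)
          (Submodule.smul_mem _ _ (Submodule.subset_span ⟨_, rfl⟩))
      · refine Fin.cases hx0 (fun i => ?_) i
        have h1 : x i.succ = y' i + aeval y (MvPolynomial.C (v i) : MvPolynomial (Fin m) ℂ) * x 0 := by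
          simp [hy', Algebra.smul_def]
        rw [h1]
        exact (hint i).add _ (((aeval y : MvPolynomial (Fin m) ℂ →ₐ[ℂ] R) :
          MvPolynomial (Fin m) ℂ →+* R).isIntegralElem_map.mul _ hx0)
      · refine ⟨C + (1 + ∑ i, ‖v i‖) * (B * (1 + N * C)), by positivity, fun φ i => ?_⟩
        have hS : 0 ≤ ∑ j, ‖φ (y j)‖ := Finset.sum_nonneg fun _ _ => norm_nonneg _
        have hV : 0 ≤ ∑ i, ‖v i‖ := Finset.sum_nonneg fun _ _ => norm_nonneg _
        have hQ : 0 ≤ (B * (1 + N * C)) * (1 + ∑ j, ‖φ (y j)‖) := by positivity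
        have hQ' : 0 ≤ C * (1 + ∑ j, ‖φ (y j)‖) := by positivity
        have h0 := hb0 φ
        rw [add_mul, mul_assoc (1 + ∑ i, ‖v i‖)]
        refine Fin.cases ?_ (fun i => ?_) i
        · nlinarith
        · have h1 : x i.succ = y' i + v i • x 0 := by simp [hy']
          rw [h1, map_add, map_smul]
          refine (norm_add_le _ _).trans (add_le_add (hb φ i) ?_)
          rw [norm_smul]
          have := Finset.single_le_sum (f := fun i => ‖v i‖) (fun _ _ => norm_nonneg _)
            (Finset.mem_univ i)
          gcongr
          linarith

lemma aux_lift {R : Type*} [CommRing R] [IsDomain R] [Algebra ℂ R] [Algebra.FiniteType ℂ R]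
    {m : ℕ} (y : Fin m → R) (hy : AlgebraicIndependent ℂ y)
    (hint : ((aeval y : MvPolynomial (Fin m) ℂ →ₐ[ℂ] R) :
        MvPolynomial (Fin m) ℂ →+* R).IsIntegral) (g : R) :
    ∃ μ : Polynomial (MvPolynomial (Fin m) ℂ), μ.Monic ∧
      μ.eval₂ ((aeval y : MvPolynomial (Fin m) ℂ →ₐ[ℂ] R) :
        MvPolynomial (Fin m) ℂ →+* R) g = 0 ∧
      ∀ (y0 : Fin m → ℂ) (t0 : ℂ), μ.eval₂ (eval y0) t0 = 0 →
        ∃ φ : R →ₐ[ℂ] ℂ, (∀ j, φ (y j) = y0 j) ∧ φ g = t0 := by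
  let h : MvPolynomial (Fin m) ℂ →+* R := (aeval y : MvPolynomial (Fin m) ℂ →ₐ[ℂ] R)
  let _ : Algebra (MvPolynomial (Fin m) ℂ) R := h.toAlgebra
  have : Module.IsTorsionFree (MvPolynomial (Fin m) ℂ) R := by
    have : FaithfulSMul (MvPolynomial (Fin m) ℂ) R :=
      (faithfulSMul_iff_algebraMap_injective _ _).2 hy
    infer_instance
  have hg : IsIntegral (MvPolynomial (Fin m) ℂ) g := hint g
  refine ⟨minpoly (MvPolynomial (Fin m) ℂ) g, minpoly.monic hg,
    minpoly.aeval (MvPolynomial (Fin m) ℂ) g, fun y0 t0 h0 => ?_⟩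
  let e : Polynomial (MvPolynomial (Fin m) ℂ) →+* R :=
    (Polynomial.aeval g : Polynomial (MvPolynomial (Fin m) ℂ) →ₐ[MvPolynomial (Fin m) ℂ] R)
  let ψ : Polynomial (MvPolynomial (Fin m) ℂ) →+* ℂ := Polynomial.eval₂RingHom (eval y0) t0
  have hψ : Function.Surjective ψ := fun a => ⟨Polynomial.C (C a), by simp [ψ]⟩
  have hmax : (RingHom.ker ψ).IsMaximal := RingHom.ker_isMaximal_of_surjective ψ hψ
  have hker : RingHom.ker e ≤ RingHom.ker ψ := by
    have h1 : RingHom.ker e = Ideal.span {minpoly (MvPolynomial (Fin m) ℂ) g} :=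
      minpoly.ker_eval hg
    rw [h1, Ideal.span_le, Set.singleton_subset_iff]
    exact h0
  let _ : Algebra (Polynomial (MvPolynomial (Fin m) ℂ)) R := e.toAlgebra
  have : Algebra.IsIntegral (Polynomial (MvPolynomial (Fin m) ℂ)) R := by
    refine ⟨fun r => ?_⟩
    obtain ⟨p, hp, hpr⟩ := hint r
    refine ⟨p.map Polynomial.C, hp.map _, ?_⟩
    rw [Polynomial.eval₂_map]
    have h2 : (algebraMap (Polynomial (MvPolynomial (Fin m) ℂ)) R).comp Polynomial.C = h := by
      refine RingHom.ext fun a => ?_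
      change e (Polynomial.C a) = h a
      simp only [e, RingHom.coe_coe, Polynomial.aeval_C]
      rfl
    rw [h2]
    exact hpr
  obtain ⟨Q, hQ, hQc⟩ := Ideal.exists_ideal_over_maximal_of_isIntegral (S := R)
    (RingHom.ker ψ) hker
  let _ : Field (R ⧸ Q) := Ideal.Quotient.field Q
  have : Algebra.FiniteType ℂ (R ⧸ Q) := inferInstance
  have : Module.Finite ℂ (R ⧸ Q) := finite_of_finite_type_of_isJacobsonRing ℂ (R ⧸ Q)
  have hbij : Function.Bijective (algebraMap ℂ (R ⧸ Q)) :=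
    IsAlgClosed.algebraMap_bijective_of_isIntegral
  let ι : ℂ ≃ₐ[ℂ] (R ⧸ Q) := AlgEquiv.ofBijective (Algebra.ofId ℂ (R ⧸ Q)) hbij
  let φ : R →ₐ[ℂ] ℂ := (ι.symm : (R ⧸ Q) →ₐ[ℂ] ℂ).comp (Ideal.Quotient.mkₐ ℂ Q)
  have hφQ : ∀ r ∈ Q, φ r = 0 := by
    intro r hr
    have : Ideal.Quotient.mkₐ ℂ Q r = 0 := Ideal.Quotient.eq_zero_iff_mem.2 hr
    simp only [φ, AlgHom.comp_apply, this, map_zero]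
  have hkey : ∀ p, φ (e p) = ψ p := by
    intro p
    have h1 : p - Polynomial.C (C (ψ p)) ∈ RingHom.ker ψ := by
      rw [RingHom.mem_ker, map_sub]; simp [ψ]
    rw [← hQc] at h1
    have h2 := hφQ _ (Ideal.mem_comap.1 h1)
    change φ (e _) = 0 at h2
    rw [map_sub, map_sub, sub_eq_zero] at h2
    rw [h2]
    have h3 : e (Polynomial.C (C (ψ p))) = algebraMap ℂ R (ψ p) := by
      simp only [e, RingHom.coe_coe, Polynomial.aeval_C]
      change aeval y (C (ψ p)) = _
      simp
    rw [h3, AlgHom.commutes]; rfl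
  refine ⟨φ, fun j => ?_, ?_⟩
  · have h1 := hkey (Polynomial.C (X j))
    have h3 : e (Polynomial.C (X j)) = y j := by
      simp only [e, RingHom.coe_coe, Polynomial.aeval_C]
      change aeval y (X j) = _
      simp
    rw [h3] at h1
    rw [h1]; simp [ψ]
  · have h1 := hkey Polynomial.X
    simpa [e, ψ] using h1

lemma aux_KL {R : Type*} [CommRing R] [IsDomain R] [Algebra ℂ R] [Algebra.FiniteType ℂ R]
    {N : ℕ} (x : Fin N → R) (hx : Algebra.adjoin ℂ (range x) = ⊤) (g : R) (s0 : ℝ) (hs0 : 0 ≤ s0)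
    (hg : ∀ s > s0, ∃ C : ℝ, 0 ≤ C ∧ ∀ φ : R →ₐ[ℂ] ℂ, ‖φ g‖ ≤ C * (1 + ∑ i, ‖φ (x i)‖) ^ s) :
    ∃ (n : ℕ) (a : ℕ → MvPolynomial (Fin N) ℂ),
      (∀ i < n, ((a i).totalDegree : ℝ) ≤ s0 * ((n : ℝ) - i)) ∧
      g ^ n + ∑ i ∈ Finset.range n, aeval x (a i) * g ^ i = 0 := by
  obtain ⟨m, y, hy, hspan, hint, C1, hC1, hb⟩ := aux_noether N x
  have hint' : ((aeval y : MvPolynomial (Fin m) ℂ →ₐ[ℂ] R) :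
        MvPolynomial (Fin m) ℂ →+* R).IsIntegral := by
    intro r
    have hr : r ∈ Algebra.adjoin ℂ (range x) := by rw [hx]; trivial
    induction hr using Algebra.adjoin_induction with
    | mem _ h => obtain ⟨i, rfl⟩ := h; exact hint i
    | algebraMap c =>
      have := ((aeval y : MvPolynomial (Fin m) ℂ →ₐ[ℂ] R) :
        MvPolynomial (Fin m) ℂ →+* R).isIntegralElem_map (x := C c)
      simpa using this
    | add a b _ _ ha hb => exact ha.add _ hb
    | mul a b _ _ ha hb => exact ha.mul _ hb
  obtain ⟨μ, hμ, hμg, hroots⟩ := aux_lift y hy hint' g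
  have hlin : ∀ j, ∃ ℓ : MvPolynomial (Fin N) ℂ, ℓ.totalDegree ≤ 1 ∧ aeval x ℓ = y j := by
    intro j
    obtain ⟨c, hc⟩ := (Submodule.mem_span_range_iff_exists_fun ℂ).1 (hspan j)
    refine ⟨∑ i, MvPolynomial.C (c i) * X i, totalDegree_finsetSum_le fun i _ => ?_, ?_⟩
    · exact (totalDegree_mul _ _).trans (by simp)
    · rw [← hc, map_sum]
      simp [Algebra.smul_def]
  choose ℓ hℓ1 hℓ2 using hlin
  have hcomp : ∀ p : MvPolynomial (Fin m) ℂ, aeval x (aeval ℓ p) = aeval y p := by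
    intro p
    have : (aeval x : MvPolynomial (Fin N) ℂ →ₐ[ℂ] R).comp (aeval ℓ) = aeval y := by
      ext j; simp [hℓ2]
    exact congrArg (fun h => h p) this
  set n := μ.natDegree with hn
  refine ⟨n, fun i => aeval ℓ (μ.coeff i), fun i hi => ?_, ?_⟩
  · refine le_trans (Nat.cast_le.2 (aux_totalDegree_aeval (μ.coeff i) ℓ hℓ1)) ?_
    have hni : (0 : ℝ) < (n : ℝ) - i := by
      have : (i : ℝ) < n := by exact_mod_cast hi
      linarith
    have hcast : ((n - i : ℕ) : ℝ) = (n : ℝ) - i := by push_cast [hi.le]; ring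
    have key : ∀ s > s0, ((μ.coeff i).totalDegree : ℝ) ≤ s * ((n : ℝ) - i) := by
      intro s hs
      obtain ⟨C, hC, hCb⟩ := hg s hs
      have hspos : 0 ≤ s := by linarith
      refine aux_degree_le (μ.coeff i) (s * ((n : ℝ) - i))
        ((C * (1 + N * C1) ^ s) ^ (n - i) * n.choose i) (by positivity) (by positivity)
        fun v => ?_
      have hS : 0 ≤ ∑ j, ‖v j‖ := Finset.sum_nonneg fun _ _ => norm_nonneg _
      have h1 := Polynomial.coeff_le_of_roots_le (p := μ) (f := eval v)
        (B := C * (1 + N * C1) ^ s * (1 + ∑ j, ‖v j‖) ^ s) i hμ (IsAlgClosed.splits _) ?_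
      · rw [Polynomial.coeff_map] at h1
        refine h1.trans (le_of_eq ?_)
        rw [Real.rpow_mul (by positivity), ← hcast, Real.rpow_natCast, ← hn, mul_pow (C * _)]
        ring
      · intro t ht
        have ht' := (Polynomial.mem_roots'.1 ht).2
        rw [Polynomial.IsRoot, Polynomial.eval_map] at ht'
        obtain ⟨φ, hφy, hφg⟩ := hroots v t ht'
        rw [← hφg]
        refine (hCb φ).trans ?_
        rw [mul_assoc, ← Real.mul_rpow (by positivity) (by positivity)]
        have h3 : ∑ i, ‖φ (x i)‖ ≤ N * (C1 * (1 + ∑ j, ‖v j‖)) := by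
          refine (Finset.sum_le_sum fun i _ => hb φ i).trans ?_
          simp [hφy]
        have h4 : 0 ≤ ∑ i, ‖φ (x i)‖ := Finset.sum_nonneg fun _ _ => norm_nonneg _
        gcongr
        nlinarith
    refine le_of_forall_pos_le_add fun ε hε => ?_
    refine (key (s0 + ε / ((n : ℝ) - i)) (by have := div_pos hε hni; linarith)).trans ?_
    rw [add_mul, div_mul_cancel₀ _ hni.ne']
  · rw [Polynomial.eval₂_eq_sum_range, Finset.sum_range_succ, ← hn, hμ.coeff_natDegree, map_one,
      one_mul] at hμg
    simp only [hcomp]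
    rw [add_comm]
    exact hμg

lemma aux_mem_vanish {N : ℕ} {A : Set (EuclideanSpace ℂ (Fin N))} {p : MvPolynomial (Fin N) ℂ} :
    p ∈ vanishIdeal A ↔ ∀ z ∈ A, evalAt z p = 0 := by
  rw [vanishIdeal, RingHom.mem_ker]
  constructor
  · intro h z hz
    exact congrFun h ⟨z, hz⟩
  · intro h
    funext z
    exact h z.1 z.2

lemma aux_KLA {N : ℕ} (A : Set (EuclideanSpace ℂ (Fin N)))
    (halg : IsAlgebraicSet A) (hprime : (vanishIdeal A).IsPrime)
    (g : MvPolynomial (Fin N) ℂ) (s0 : ℝ) (hs0 : 0 ≤ s0)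
    (hg : ∀ s > s0, ∃ C : ℝ, 0 ≤ C ∧ ∀ z ∈ A, ‖evalAt z g‖ ≤ C * (1 + ‖z‖) ^ s) :
    ∃ (n : ℕ) (a : ℕ → MvPolynomial (Fin N) ℂ),
      (∀ i < n, ((a i).totalDegree : ℝ) ≤ s0 * ((n : ℝ) - i)) ∧
      ∀ z ∈ A, evalAt z g ^ n + ∑ i ∈ Finset.range n, evalAt z (a i) * evalAt z g ^ i = 0 := by
  let I := vanishIdeal A
  let π : MvPolynomial (Fin N) ℂ →ₐ[ℂ] (MvPolynomial (Fin N) ℂ ⧸ I) := Ideal.Quotient.mkₐ ℂ I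
  have hπ : Function.Surjective π := Ideal.Quotient.mkₐ_surjective ℂ I
  have hdom : IsDomain (MvPolynomial (Fin N) ℂ ⧸ I) := Ideal.Quotient.isDomain I
  have hπx : ∀ p, aeval (fun i => π (X i)) p = π p := by
    intro p
    have : aeval (fun i => π (X i)) = π := by ext i; simp
    rw [this]
  have hgen : Algebra.adjoin ℂ (range fun i => π (X i)) = ⊤ := by
    rw [Algebra.adjoin_range_eq_range_aeval, eq_top_iff]
    intro r _
    obtain ⟨p, rfl⟩ := hπ r
    exact ⟨p, hπx p⟩
  obtain ⟨n, a, hdeg, hrel⟩ := aux_KL (fun i => π (X i)) hgen (π g) s0 hs0 (by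
    intro s hs
    obtain ⟨C, hC, hCb⟩ := hg s hs
    refine ⟨C, hC, fun φ => ?_⟩
    let z : EuclideanSpace ℂ (Fin N) := WithLp.toLp 2 (fun i => φ (π (X i)))
    have hz : ∀ p, evalAt z p = φ (π p) := by
      intro p
      have : (φ.comp π) = aeval (fun i => z i) := by ext i; simp [z]
      have := congrArg (fun h => h p) this
      simpa [evalAt, MvPolynomial.coe_aeval_eq_eval] using this.symm
    have hzA : z ∈ A := by
      obtain ⟨S, hS⟩ := halg
      rw [hS]
      intro p hp
      have hpI : p ∈ I := aux_mem_vanish.2 fun w hw => by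
        rw [hS] at hw; exact hw p hp
      have : π p = 0 := Ideal.Quotient.eq_zero_iff_mem.2 hpI
      rw [hz, this, map_zero]
    rw [← hz]
    refine (hCb z hzA).trans ?_
    have hnorm : ‖z‖ ≤ ∑ i, ‖z i‖ := by
      have h1 : z = ∑ i, EuclideanSpace.single i (z i) := by
        ext j; simp
      calc ‖z‖ = ‖∑ i, EuclideanSpace.single i (z i)‖ := by rw [← h1]
        _ ≤ ∑ i, ‖EuclideanSpace.single i (z i)‖ := norm_sum_le _ _
        _ = _ := by simp
    have hs' : 0 ≤ s := by linarith
    gcongr)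
  refine ⟨n, a, hdeg, fun z hz => ?_⟩
  simp only [hπx, ← map_pow, ← map_mul, ← map_sum, ← map_add] at hrel
  have hI : _ ∈ I := Ideal.Quotient.eq_zero_iff_mem.1 hrel
  have := aux_mem_vanish.1 hI z hz
  simpa [evalAt] using this

lemma aux_const {N : ℕ} (A : Set (EuclideanSpace ℂ (Fin N)))
    (halg : IsAlgebraicSet A) (hprime : (vanishIdeal A).IsPrime)
    (g : MvPolynomial (Fin N) ℂ)
    (hg : ∀ s > (0 : ℝ), ∃ C : ℝ, 0 ≤ C ∧ ∀ z ∈ A, ‖evalAt z g‖ ≤ C * (1 + ‖z‖) ^ s) :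
    ∃ c : ℂ, ∀ z ∈ A, evalAt z g = c := by
  obtain ⟨n, a, hdeg, hrel⟩ := aux_KLA A halg hprime g 0 le_rfl hg
  have ha : ∀ i < n, a i = C (coeff 0 (a i)) := by
    intro i hi
    have h := hdeg i hi
    rw [zero_mul] at h
    rw [← totalDegree_eq_zero_iff_eq_C]
    exact_mod_cast le_antisymm h (by positivity)
  set μ : Polynomial ℂ := Polynomial.X ^ n +
    ∑ i ∈ Finset.range n, Polynomial.C (coeff 0 (a i)) * Polynomial.X ^ i with hμ
  have hmon : μ.Monic := by
    refine Polynomial.monic_X_pow_add ?_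
    refine (Polynomial.degree_sum_le _ _).trans_lt ?_
    refine (Finset.sup_lt_iff (WithBot.bot_lt_coe n)).2 fun i hi => ?_
    exact (Polynomial.degree_C_mul_X_pow_le i _).trans_lt
      (WithBot.coe_lt_coe.2 (Finset.mem_range.1 hi))
  have hprod : (μ.roots.map fun r => Polynomial.X - Polynomial.C r).prod = μ := by
    have h := (IsAlgClosed.splits μ).eq_prod_roots
    rw [hmon.leadingCoeff, Polynomial.C_1, one_mul] at h
    exact h.symm
  have hmem : (μ.roots.map fun r => g - C r).prod ∈ vanishIdeal A := by
    rw [aux_mem_vanish]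
    intro z hz
    have h1 : evalAt z (μ.roots.map fun r => g - C r).prod = μ.eval (evalAt z g) := by
      conv_rhs => rw [← hprod]
      rw [Polynomial.eval_multiset_prod, evalAt, map_multiset_prod]
      simp [Multiset.map_map, Function.comp_def, evalAt]
    rw [h1, ← hrel z hz, hμ]
    simp only [Polynomial.eval_add, Polynomial.eval_pow, Polynomial.eval_X,
      Polynomial.eval_finsetSum, Polynomial.eval_mul, Polynomial.eval_C]
    congr 1
    refine Finset.sum_congr rfl fun i hi => ?_
    conv_rhs => rw [ha i (Finset.mem_range.1 hi)]
    simp [evalAt]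
  rw [hprime.multiset_prod_mem_iff_exists_mem] at hmem
  obtain ⟨p, hp, hpI⟩ := hmem
  obtain ⟨r, -, rfl⟩ := Multiset.mem_map.1 hp
  refine ⟨r, fun z hz => ?_⟩
  have := aux_mem_vanish.1 hpI z hz
  simp only [evalAt, map_sub, eval_C] at this
  exact sub_eq_zero.1 this

lemma aux_powers {N : ℕ} (A : Set (EuclideanSpace ℂ (Fin N)))
    (halg : IsAlgebraicSet A) (hprime : (vanishIdeal A).IsPrime)
    (g : MvPolynomial (Fin N) ℂ) (s0 : ℝ) (hs0 : 0 ≤ s0)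
    (hg : ∀ s > s0, ∃ C : ℝ, 0 ≤ C ∧ ∀ z ∈ A, ‖evalAt z g‖ ≤ C * (1 + ‖z‖) ^ s) :
    ∃ c : ℝ, 0 ≤ c ∧ ∀ k : ℕ, ∃ Q : MvPolynomial (Fin N) ℂ,
      (Q.totalDegree : ℝ) ≤ k * s0 + c ∧ ∀ z ∈ A, evalAt z Q = evalAt z g ^ k := by
  obtain ⟨n, a, hdeg, hrel⟩ := aux_KLA A halg hprime g s0 hs0 hg
  refine ⟨n * g.totalDegree, by positivity, fun k => ?_⟩
  induction k using Nat.strong_induction_on with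
  | _ k ih =>
    by_cases hk : k < n
    · refine ⟨g ^ k, ?_, fun z _ => by simp [evalAt]⟩
      have h1 : ((g ^ k).totalDegree : ℝ) ≤ k * g.totalDegree := by
        exact_mod_cast totalDegree_pow g k
      have h2 : (k : ℝ) * g.totalDegree ≤ n * g.totalDegree := by gcongr
      have h3 : 0 ≤ (k : ℝ) * s0 := by positivity
      linarith
    · push Not at hk
      have ih' : ∀ i, ∃ Q : MvPolynomial (Fin N) ℂ, i < n →
          ((Q.totalDegree : ℝ) ≤ (k - n + i : ℕ) * s0 + n * g.totalDegree ∧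
            ∀ z ∈ A, evalAt z Q = evalAt z g ^ (k - n + i)) := by
        intro i
        by_cases hi : i < n
        · obtain ⟨Q, hQ⟩ := ih (k - n + i) (by omega)
          exact ⟨Q, fun _ => hQ⟩
        · exact ⟨0, fun h => absurd h hi⟩
      choose Q hQ using ih'
      refine ⟨- ∑ i ∈ Finset.range n, a i * Q i, ?_, fun z hz => ?_⟩
      · rw [totalDegree_neg]
        have hnn : 0 ≤ (k : ℝ) * s0 + n * g.totalDegree := by positivity
        refine le_trans ?_ (Nat.floor_le hnn)
        norm_cast
        refine totalDegree_finsetSum_le fun i hi => Nat.le_floor ?_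
        have hi' := Finset.mem_range.1 hi
        have h1 : ((a i * Q i).totalDegree : ℝ) ≤ (a i).totalDegree + (Q i).totalDegree := by
          exact_mod_cast totalDegree_mul _ _
        have h2 := hdeg i hi'
        have h3 := (hQ i hi').1
        have h4 : ((k - n + i : ℕ) : ℝ) = k - n + i := by push_cast [hk]; ring
        rw [h4] at h3
        push_cast
        nlinarith
      · have h1 := hrel z hz
        have h2 : evalAt z g ^ n = - ∑ i ∈ Finset.range n, evalAt z (a i) * evalAt z g ^ i := by
          linear_combination h1
        have h3 : evalAt z g ^ k = evalAt z g ^ (k - n) * evalAt z g ^ n := by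
          rw [← pow_add, Nat.sub_add_cancel hk]
        rw [h3, h2, mul_neg, Finset.mul_sum]
        have h4 : evalAt z (- ∑ i ∈ Finset.range n, a i * Q i)
            = - ∑ i ∈ Finset.range n, evalAt z (a i) * evalAt z (Q i) := by
          simp [evalAt]
        rw [h4]
        congr 1
        refine Finset.sum_congr rfl fun i hi => ?_
        rw [(hQ i (Finset.mem_range.1 hi)).2 z hz, pow_add]
        ring

lemma aux_norm_le_sum {n : ℕ} (z : EuclideanSpace ℂ (Fin n)) : ‖z‖ ≤ ∑ i, ‖z i‖ := by
  have h1 : z = ∑ i, EuclideanSpace.single i (z i) := by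
    ext j; simp
  calc ‖z‖ = ‖∑ i, EuclideanSpace.single i (z i)‖ := by rw [← h1]
    _ ≤ ∑ i, ‖EuclideanSpace.single i (z i)‖ := norm_sum_le _ _
    _ = _ := by simp

lemma aux_sum_le_norm {n : ℕ} (z : EuclideanSpace ℂ (Fin n)) : ∑ i, ‖z i‖ ≤ n * ‖z‖ := by
  refine (Finset.sum_le_sum fun i _ => PiLp.norm_apply_le z i).trans ?_
  simp

/-- an infinite irreducible algebraic set is unbounded. -/
lemma aux_unbounded {N : ℕ} (A : Set (EuclideanSpace ℂ (Fin N)))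
    (halg : IsAlgebraicSet A) (hprime : (vanishIdeal A).IsPrime) (hinf : A.Infinite) (r : ℝ) :
    ∃ z ∈ A, r < ‖z‖ := by
  by_contra hcon
  push Not at hcon
  have hconst : ∀ i, ∃ c : ℂ, ∀ z ∈ A, evalAt z (X i) = c := by
    intro i
    refine aux_const A halg hprime (X i) fun s hs => ⟨|r|, abs_nonneg _, fun z hz => ?_⟩
    have h1 : ‖evalAt z (X i)‖ ≤ |r| := by
      rw [evalAt, eval_X]
      exact (PiLp.norm_apply_le z i).trans ((hcon z hz).trans (le_abs_self r))
    refine h1.trans (le_mul_of_one_le_right (abs_nonneg _) ?_)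
    exact Real.one_le_rpow (by have := norm_nonneg z; linarith) hs.le
  choose c hc using hconst
  refine hinf (Set.Subsingleton.finite fun z hz w hw => ?_)
  ext i
  have h1 := hc i z hz
  have h2 := hc i w hw
  simp only [evalAt, eval_X] at h1 h2
  rw [h1, h2]

lemma aux_eventually {E : Type*} [Norm E] {V : Set E} {p : E → Prop} :
    (∀ᶠ z in atInftyOn V, p z) ↔ ∃ r : ℝ, ∀ z ∈ V, r ≤ ‖z‖ → p z := by
  rw [atInftyOn, eventually_inf_principal, eventually_comap, eventually_atTop]
  constructor
  · rintro ⟨r, h⟩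
    exact ⟨r, fun z hz hr => h _ hr z rfl hz⟩
  · rintro ⟨r, h⟩
    exact ⟨r, fun b hb z hz hzV => h z hzV (hz ▸ hb)⟩

lemma aux_bound_norm {n : ℕ} (F : MvPolynomial (Fin n) ℂ) (k : ℕ) (hk : F.totalDegree ≤ k) :
    ∃ C : ℝ, 0 ≤ C ∧ ∀ z : EuclideanSpace ℂ (Fin n), ‖evalAt z F‖ ≤ C * (1 + ‖z‖) ^ k := by
  obtain ⟨C, hC, h⟩ := aux_bound F k hk
  refine ⟨C * (1 + n) ^ k, by positivity, fun z => ?_⟩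
  have h0 := norm_nonneg z
  have hn : (0 : ℝ) ≤ n := by positivity
  calc ‖evalAt z F‖ ≤ C * (1 + ∑ i, ‖z i‖) ^ k := h _
    _ ≤ C * ((1 + n) * (1 + ‖z‖)) ^ k := by
        have := aux_sum_le_norm z
        gcongr
        nlinarith
    _ = _ := by rw [mul_pow]; ring

lemma aux_fgrow {N M : ℕ} (A : Set (EuclideanSpace ℂ (Fin N)))
    (f : EuclideanSpace ℂ (Fin N) → EuclideanSpace ℂ (Fin M))
    (P : Fin M → MvPolynomial (Fin N) ℂ) (hP : ∀ z ∈ A, ∀ j, f z j = evalAt z (P j)) :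
    ∃ C : ℝ, 0 ≤ C ∧ ∃ D : ℕ, ∀ z ∈ A, ‖f z‖ ≤ C * (1 + ‖z‖) ^ D := by
  have h : ∀ j, ∃ C : ℝ, 0 ≤ C ∧ ∀ z : EuclideanSpace ℂ (Fin N),
      ‖evalAt z (P j)‖ ≤ C * (1 + ‖z‖) ^ (∑ j, (P j).totalDegree) := fun j =>
    aux_bound_norm (P j) _
      (Finset.single_le_sum (f := fun j => (P j).totalDegree) (fun _ _ => Nat.zero_le _)
        (Finset.mem_univ j))
  choose C hC hb using h
  refine ⟨∑ j, C j, Finset.sum_nonneg fun j _ => hC j,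
    ∑ j, (P j).totalDegree, fun z hz => ?_⟩
  refine (aux_norm_le_sum _).trans ?_
  rw [Finset.sum_mul]
  refine Finset.sum_le_sum fun j _ => ?_
  rw [hP z hz j]
  exact hb j z

lemma aux_neBot {N : ℕ} (A : Set (EuclideanSpace ℂ (Fin N)))
    (halg : IsAlgebraicSet A) (hprime : (vanishIdeal A).IsPrime) (hinf : A.Infinite) :
    (atInftyOn A).NeBot := by
  rw [← Filter.eventually_false_iff_eq_bot.not.trans Filter.neBot_iff.symm |>.symm.symm]
  rw [aux_eventually]
  rintro ⟨r, h⟩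
  obtain ⟨z, hz, hr⟩ := aux_unbounded A halg hprime hinf r
  exact h z hz hr.le

lemma aux_flarge {N M : ℕ} (A : Set (EuclideanSpace ℂ (Fin N)))
    (f : EuclideanSpace ℂ (Fin N) → EuclideanSpace ℂ (Fin M))
    (hproper : ∀ K : Set (EuclideanSpace ℂ (Fin M)), IsCompact K → IsCompact (A ∩ f ⁻¹' K)) :
    ∃ r : ℝ, 1 < r ∧ ∀ z ∈ A, r ≤ ‖z‖ → 1 < ‖f z‖ := by
  have h := (hproper (closedBall 0 1) (isCompact_closedBall 0 1)).isBounded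
  obtain ⟨r, hr⟩ := h.exists_norm_le
  refine ⟨max r 1 + 1, by have := le_max_right r 1; linarith, fun z hz hzr => ?_⟩
  by_contra hcon
  push Not at hcon
  have := hr z ⟨hz, by simpa using hcon⟩
  have := le_max_left r 1
  linarith

lemma aux_logRatio {E F : Type*} [Norm E] [Norm F] (f : E → F) (z : E)
    (h1 : 1 < ‖z‖) (h2 : 1 < ‖f z‖) :
    logRatio f z = ((Real.log ‖f z‖ / Real.log ‖z‖ : ℝ) : EReal) := by
  rw [logRatio, elog, elog, if_neg (by linarith), if_neg (by linarith), EReal.coe_div]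

lemma aux_growth {N M : ℕ} (A : Set (EuclideanSpace ℂ (Fin N)))
    (f : EuclideanSpace ℂ (Fin N) → EuclideanSpace ℂ (Fin M))
    (halg : IsAlgebraicSet A) (hprime : (vanishIdeal A).IsPrime) (hinf : A.Infinite)
    (hpoly : IsPolyMapOn f A)
    (hproper : ∀ K : Set (EuclideanSpace ℂ (Fin M)), IsCompact K → IsCompact (A ∩ f ⁻¹' K)) :
    ∃ r : ℝ, 0 ≤ r ∧ growthExp f A = (r : EReal) ∧
      ∀ s > r, ∃ C : ℝ, 0 ≤ C ∧ ∀ z ∈ A, ‖f z‖ ≤ C * (1 + ‖z‖) ^ s := by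
  obtain ⟨P, hP⟩ := hpoly
  obtain ⟨C, hC, D, hD⟩ := aux_fgrow A f P hP
  obtain ⟨r1, hr1, hfl⟩ := aux_flarge A f hproper
  have hne := aux_neBot A halg hprime hinf
  have h0 : 0 ≤ growthExp f A := by
    refine le_limsup_of_frequently_le (Eventually.frequently ?_)
    rw [aux_eventually]
    refine ⟨r1, fun z hz hr => ?_⟩
    rw [aux_logRatio f z (by linarith) (hfl z hz hr)]
    have h1 := Real.log_pos (hfl z hz hr)
    have h2 := Real.log_pos (hr1.trans_le hr)
    exact_mod_cast (div_pos h1 h2).le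
  have hup : growthExp f A ≤ ((D + 1 : ℝ) : EReal) := by
    refine limsup_le_of_le (h := ?_)
    rw [aux_eventually]
    refine ⟨max r1 (C * 2 ^ D), fun z hz hr => ?_⟩
    have hr2 := (le_max_left _ _).trans hr
    have hr3 := (le_max_right _ _).trans hr
    rw [aux_logRatio f z (by linarith) (hfl z hz hr2)]
    have h1 := hfl z hz hr2
    have h2 := Real.log_pos (hr1.trans_le hr2)
    norm_cast
    rw [div_le_iff₀ h2]
    have h3 : ‖f z‖ ≤ ‖z‖ ^ (D + 1) := by
      calc ‖f z‖ ≤ C * (1 + ‖z‖) ^ D := hD z hz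
        _ ≤ C * (2 * ‖z‖) ^ D := by gcongr; linarith
        _ = (C * 2 ^ D) * ‖z‖ ^ D := by rw [mul_pow]; ring
        _ ≤ ‖z‖ * ‖z‖ ^ D := by gcongr
        _ = _ := by ring
    have h4 := Real.log_le_log (by linarith) h3
    rw [Real.log_pow] at h4
    exact_mod_cast h4
  lift growthExp f A to ℝ using ⟨(hup.trans_lt (EReal.coe_lt_top _)).ne,
    (EReal.bot_lt_zero.trans_le h0).ne'⟩ with r hr
  refine ⟨r, by exact_mod_cast h0, rfl, fun s hs => ?_⟩
  have hs0 : 0 ≤ s := le_trans (by exact_mod_cast h0) hs.le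
  have hev : ∀ᶠ z in atInftyOn A, logRatio f z < (s : EReal) := by
    refine eventually_lt_of_limsup_lt ?_
    change growthExp f A < _
    rw [← hr]
    exact_mod_cast hs
  rw [aux_eventually] at hev
  obtain ⟨r2, hr2⟩ := hev
  refine ⟨1 + C * (1 + max r1 r2) ^ D, by positivity, fun z hz => ?_⟩
  have hz0 := norm_nonneg z
  have hone : 1 ≤ (1 + ‖z‖) ^ s := Real.one_le_rpow (by linarith) hs0
  have hCD : 0 ≤ C * (1 + max r1 r2) ^ D := by positivity
  by_cases hbig : max r1 r2 ≤ ‖z‖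
  · have h1 := (le_max_left _ _).trans hbig
    have h2 := hr2 z hz ((le_max_right _ _).trans hbig)
    have h5 := hfl z hz h1
    rw [aux_logRatio f z (by linarith) h5] at h2
    have h3 := Real.log_pos (hr1.trans_le h1)
    norm_cast at h2
    rw [div_lt_iff₀ h3] at h2
    have hzp : 0 < ‖z‖ := by linarith
    have h4 : ‖f z‖ ≤ ‖z‖ ^ s := by
      rw [← Real.log_le_log_iff (by linarith) (by positivity), Real.log_rpow hzp]
      exact h2.le
    have h6 : ‖z‖ ^ s ≤ (1 + ‖z‖) ^ s := Real.rpow_le_rpow hz0 (by linarith) hs0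
    nlinarith
  · push Not at hbig
    have h1 : ‖f z‖ ≤ C * (1 + max r1 r2) ^ D := (hD z hz).trans (by gcongr)
    nlinarith

lemma aux_comp_growth {N M : ℕ} (A : Set (EuclideanSpace ℂ (Fin N)))
    (f : EuclideanSpace ℂ (Fin N) → EuclideanSpace ℂ (Fin M))
    (q : MvPolynomial (Fin M) ℂ) (g : MvPolynomial (Fin N) ℂ)
    (hgq : ∀ z ∈ A, evalAt z g = evalAt (f z) q) (hd : 1 ≤ q.totalDegree)
    (r : ℝ) (hr : 0 ≤ r)
    (hf : ∀ s > r, ∃ C : ℝ, 0 ≤ C ∧ ∀ z ∈ A, ‖f z‖ ≤ C * (1 + ‖z‖) ^ s) :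
    ∀ t > q.totalDegree * r, ∃ C : ℝ, 0 ≤ C ∧ ∀ z ∈ A, ‖evalAt z g‖ ≤ C * (1 + ‖z‖) ^ t := by
  intro t ht
  have hd' : (0 : ℝ) < q.totalDegree := by exact_mod_cast hd
  have hs : t / q.totalDegree > r := by
    rw [gt_iff_lt, lt_div_iff₀ hd']; linarith
  obtain ⟨C, hC, h⟩ := hf _ hs
  obtain ⟨C', hC', h'⟩ := aux_bound_norm q _ le_rfl
  refine ⟨C' * (1 + C) ^ q.totalDegree, by positivity, fun z hz => ?_⟩
  have hz0 := norm_nonneg z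
  have hone : 1 ≤ (1 + ‖z‖) ^ (t / q.totalDegree) :=
    Real.one_le_rpow (by linarith) (hr.trans hs.lt.le)
  rw [hgq z hz]
  calc ‖evalAt (f z) q‖ ≤ C' * (1 + ‖f z‖) ^ q.totalDegree := h' _
    _ ≤ C' * ((1 + C) * (1 + ‖z‖) ^ (t / q.totalDegree)) ^ q.totalDegree := by
        have := h z hz
        gcongr
        nlinarith
    _ = C' * (1 + C) ^ q.totalDegree * (1 + ‖z‖) ^ t := by
        rw [mul_pow, ← Real.rpow_natCast ((1 + ‖z‖) ^ (t / q.totalDegree)),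
          ← Real.rpow_mul (by positivity), div_mul_cancel₀ _ hd'.ne', mul_assoc]

lemma aux_green_nonneg {n : ℕ} (hn : 0 < n) (E : Set (EuclideanSpace ℂ (Fin n)))
    (hE : Bornology.IsBounded E) (z : EuclideanSpace ℂ (Fin n)) : 0 ≤ greenV E z := by
  obtain ⟨R, hR⟩ := hE.exists_norm_le
  have hpos : 0 < |R| + 1 := by positivity
  have hne : (((|R| + 1)⁻¹ : ℝ) : ℂ) ≠ 0 := by
    exact_mod_cast (inv_pos.2 hpos).ne'
  have hdeg : (C (((|R| + 1)⁻¹ : ℝ) : ℂ) * X (⟨0, hn⟩ : Fin n)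
      : MvPolynomial (Fin n) ℂ).totalDegree = 1 := by
    rw [X, C_mul_monomial, totalDegree_monomial _ (by simpa using hne)]
    simp
  have hmem : (((((C (((|R| + 1)⁻¹ : ℝ) : ℂ) * X (⟨0, hn⟩ : Fin n)
      : MvPolynomial (Fin n) ℂ).totalDegree : ℝ))⁻¹ * max (Real.log ‖evalAt z
        (C (((|R| + 1)⁻¹ : ℝ) : ℂ) * X (⟨0, hn⟩ : Fin n))‖) 0 : ℝ) : EReal) ≤ greenV E z := by
    refine le_sSup ⟨_, hdeg.ge, fun w hw => ?_, rfl⟩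
    rw [evalAt, map_mul, eval_C, eval_X, norm_mul, Complex.norm_real, Real.norm_eq_abs,
      abs_of_pos (inv_pos.2 hpos), inv_mul_le_iff₀ hpos, mul_one]
    have h1 := PiLp.norm_apply_le w (⟨0, hn⟩ : Fin n)
    have h2 := hR w hw
    have h3 := le_abs_self R
    linarith
  refine le_trans ?_ hmem
  norm_cast
  positivity

lemma aux_deg_zero {n : ℕ} (Q : MvPolynomial (Fin n) ℂ) (hQ : Q.totalDegree = 0)
    (z w : EuclideanSpace ℂ (Fin n)) : evalAt z Q = evalAt w Q := by
  rw [totalDegree_eq_zero_iff_eq_C] at hQ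
  rw [hQ]
  simp [evalAt]

lemma aux_arch {L a b : ℝ} (h : ∀ k : ℕ, 1 ≤ k → k * L ≤ k * a + b) : L ≤ a := by
  by_contra hcon
  push Not at hcon
  obtain ⟨k, hk⟩ := exists_nat_gt (|b| / (L - a))
  have h1 : 0 < L - a := by linarith
  rw [div_lt_iff₀ h1] at hk
  have hk1 : 1 ≤ k := by
    rcases Nat.eq_zero_or_pos k with rfl | h
    · have := abs_nonneg b
      simp at hk
      linarith
    · exact h
  have := h k hk1
  have := le_abs_self b
  linarith

/-- Let `𝒜 ⊆ ℂᴺ` be an irreducible algebraic set of positive dimension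
(equiv., infinite) and `f : 𝒜 → ℂᴹ` a proper polynomial mapping on `𝒜`. Then
`ρ(f,𝒜)` is finite and nonnegative, and for every nonempty compact `K ⊆ f(𝒜)` and every
`z ∈ 𝒜`: `V_K(f z) ≤ ρ(f,𝒜) · V_{f⁻¹(K)}(z)`. -/
theorem statement12 {N M : ℕ} (A : Set (EuclideanSpace ℂ (Fin N)))
    (f : EuclideanSpace ℂ (Fin N) → EuclideanSpace ℂ (Fin M))
    (halg : IsAlgebraicSet A) (hprime : (vanishIdeal A).IsPrime) (hinf : A.Infinite)
    (hpoly : IsPolyMapOn f A)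
    (hproper : ∀ K : Set (EuclideanSpace ℂ (Fin M)), IsCompact K → IsCompact (A ∩ f ⁻¹' K)) :
    0 ≤ growthExp f A ∧ growthExp f A < ⊤ ∧
    ∀ K : Set (EuclideanSpace ℂ (Fin M)), K ⊆ f '' A → K.Nonempty → IsCompact K →
      ∀ z ∈ A, greenV K (f z) ≤ growthExp f A * greenV (A ∩ f ⁻¹' K) z := by
  obtain ⟨r, hr0, hr, hf⟩ := aux_growth A f halg hprime hinf hpoly hproper
  rw [hr]
  refine ⟨by exact_mod_cast hr0, EReal.coe_lt_top _, ?_⟩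
  intro K hK hKne hKc z hz
  obtain ⟨P, hP⟩ := hpoly
  have hN : 0 < N := by
    rcases Nat.eq_zero_or_pos N with rfl | h
    · exact absurd (Set.toFinite A) hinf
    · exact h
  have hV0 := aux_green_nonneg hN (A ∩ f ⁻¹' K) (hproper K hKc).isBounded z
  obtain ⟨w0, hw0⟩ : ∃ w0, w0 ∈ A ∩ f ⁻¹' K := by
    obtain ⟨y, hy⟩ := hKne
    obtain ⟨w, hw, rfl⟩ := hK hy
    exact ⟨w, hw, hy⟩
  refine sSup_le ?_
  rintro x ⟨q, hq1, hqK, rfl⟩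
  have hr0' : (0 : EReal) ≤ (r : EReal) := by exact_mod_cast hr0
  rcases le_or_gt (Real.log ‖evalAt (f z) q‖) 0 with hL | hL
  · rw [max_eq_right hL, mul_zero]
    exact mul_nonneg hr0' hV0
  rw [max_eq_left hL.le]
  have hgt : 1 < ‖evalAt (f z) q‖ := by
    by_contra hcon
    push Not at hcon
    exact absurd (Real.log_nonpos (norm_nonneg _) hcon) (not_le.2 hL)
  set g : MvPolynomial (Fin N) ℂ := aeval P q with hg
  have hgq : ∀ z ∈ A, evalAt z g = evalAt (f z) q := by
    intro z hz
    have h1 : (fun j => f z j) = fun j => eval (fun i => z i) (P j) := by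
      funext j; exact hP z hz j
    rw [evalAt, evalAt, h1, hg]
    have h2 : (aeval (fun i => z i) : MvPolynomial (Fin N) ℂ →ₐ[ℂ] ℂ) (aeval P q)
        = aeval (fun j => aeval (fun i => z i) (P j)) q := by
      rw [← AlgHom.comp_apply, comp_aeval]
    simpa [aeval_eq_eval] using h2
  have hgrow := aux_comp_growth A f q g hgq hq1 r hr0 hf
  have hg0 : ‖evalAt w0 g‖ ≤ 1 := by rw [hgq w0 hw0.1]; exact hqK _ hw0.2
  have hgz : 1 < ‖evalAt z g‖ := by rw [hgq z hz]; exact hgt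
  have hd' : (0 : ℝ) < q.totalDegree := by exact_mod_cast hq1
  rcases hr0.eq_or_lt with rfl | hrpos
  · rw [mul_zero] at hgrow
    obtain ⟨c, hc⟩ := aux_const A halg hprime g hgrow
    rw [hc z hz] at hgz
    rw [hc w0 hw0.1] at hg0
    linarith
  obtain ⟨c, hc0, hQ⟩ := aux_powers A halg hprime g _ (by positivity) hgrow
  by_cases htop : greenV (A ∩ f ⁻¹' K) z = ⊤
  · rw [htop, EReal.coe_mul_top_of_pos hrpos]
    exact le_top
  have hbd : ∀ Q : MvPolynomial (Fin N) ℂ, 1 ≤ Q.totalDegree →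
      (∀ w ∈ A ∩ f ⁻¹' K, ‖evalAt w Q‖ ≤ 1) →
      (((Q.totalDegree : ℝ)⁻¹ * max (Real.log ‖evalAt z Q‖) 0 : ℝ) : EReal)
        ≤ greenV (A ∩ f ⁻¹' K) z := fun Q h1 h2 => le_sSup ⟨Q, h1, h2, rfl⟩
  generalize greenV (A ∩ f ⁻¹' K) z = V at *
  lift V to ℝ using ⟨htop, (EReal.bot_lt_zero.trans_le hV0).ne'⟩ with v
  have hv0 : 0 ≤ v := by exact_mod_cast hV0
  norm_cast
  rw [inv_mul_le_iff₀ hd']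
  refine aux_arch (b := c * v) fun k hk => ?_
  obtain ⟨Q, hQd, hQe⟩ := hQ k
  have hQE : ∀ w ∈ A ∩ f ⁻¹' K, ‖evalAt w Q‖ ≤ 1 := by
    intro w hw
    rw [hQe w hw.1, norm_pow, hgq w hw.1]
    exact pow_le_one₀ (norm_nonneg _) (hqK _ hw.2)
  have hQz : ‖evalAt z Q‖ = ‖evalAt z g‖ ^ k := by rw [hQe z hz, norm_pow]
  have hQ1 : 1 ≤ Q.totalDegree := by
    by_contra hcon
    have h1 := aux_deg_zero Q (by omega) z w0
    have h2 := hQE w0 hw0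
    rw [← h1, hQz] at h2
    have := one_lt_pow₀ hgz (by omega : k ≠ 0)
    linarith
  have h := hbd Q hQ1 hQE
  norm_cast at h
  have hQp : (0 : ℝ) < Q.totalDegree := by exact_mod_cast hQ1
  rw [inv_mul_le_iff₀ hQp] at h
  have h2 := (le_max_left _ _).trans h
  rw [hQz, Real.log_pow, hgq z hz] at h2
  calc _ ≤ Q.totalDegree * v := h2
    _ ≤ (k * (q.totalDegree * r) + c) * v := by gcongr
    _ = _ := by ring
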